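/- arXiv:1607.01481 — 2 statements merged into one kernel-verified Lean document; each statement's English description precedes it below -/
import Mathlib

section
/- Let X be a one-sided subshift of finite type, μ a σ-invariant Borel probability measure, and let g, f : X → (0,∞) be continuous with g(x) ≤ f(x) for all x ∈ X. Then for every Borel set I ⊆ X and every t > 0 one has the inclusion {(x,s') ∈ Λ_g : Φ_g^s(x,s') ∉ I×{0} for all s ∈ [0,t]} ⊆ {(x,s') ∈ Λ_f : Φ_f^s(x,s') ∉ I×{0} for all s ∈ [0,t]} (viewing Λ_g ⊆ Λ_f), and consequently K(μ^g, t, I×{0}, Λ_g) + log(∫g dμ / ∫f dμ) ≤ K(μ^f, t, I×{0}, Λ_f). -/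
open Filter Set MeasureTheory

noncomputable section

/-- The one-sided full shift map on sequences over the alphabet `Fin a`. -/
def shiftMap (a : ℕ) : (ℕ → Fin a) → (ℕ → Fin a) := fun x n => x (n + 1)

/-- The one-sided subshift of finite type determined by the 0-1 transition matrix `A`. -/
def SFT {a : ℕ} (A : Matrix (Fin a) (Fin a) ℕ) : Set (ℕ → Fin a) :=
  {x | ∀ n, A (x n) (x (n + 1)) = 1}

/-- The cylinder of length `n` around `x`. -/
def cyl {a : ℕ} (x : ℕ → Fin a) (n : ℕ) : Set (ℕ → Fin a) := {y | ∀ i < n, y i = x i}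

/-- The Birkhoff sum `S_m f(x) = Σ_{k<m} f(σ^k x)`. -/
def birkhoff {a : ℕ} (f : (ℕ → Fin a) → ℝ) (m : ℕ) (x : ℕ → Fin a) : ℝ :=
  ∑ k ∈ Finset.range m, f ((shiftMap a)^[k] x)

/-- The suspension space `Λ_f = {(x,t) : x ∈ X, 0 ≤ t < f(x)}`. -/
def susp {a : ℕ} (X : Set (ℕ → Fin a)) (f : (ℕ → Fin a) → ℝ) : Set ((ℕ → Fin a) × ℝ) :=
  {p | p.1 ∈ X ∧ 0 ≤ p.2 ∧ p.2 < f p.1}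

open Classical in
/-- The special semi-flow `Φ_f^t` over the shift with roof function `f`:
`Φ_f^t(x,s) = (σ^m x, s + t − S_m f(x))` where `S_m f(x) ≤ s+t < S_{m+1} f(x)`. -/
def susFlow {a : ℕ} (f : (ℕ → Fin a) → ℝ) (t : ℝ) (p : (ℕ → Fin a) × ℝ) :
    (ℕ → Fin a) × ℝ :=
  if h : ∃ m : ℕ, birkhoff f m p.1 ≤ p.2 + t ∧ p.2 + t < birkhoff f (m + 1) p.1 then
    ((shiftMap a)^[h.choose] p.1, p.2 + t - birkhoff f h.choose p.1)
  else p

/-- The normalized suspension measure `μ^f = (μ × Leb)/∫ f dμ` on `Λ_f`. -/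
def suspMeasure {a : ℕ} (μ : Measure (ℕ → Fin a)) [SFinite μ] (X : Set (ℕ → Fin a))
    (f : (ℕ → Fin a) → ℝ) : Measure ((ℕ → Fin a) × ℝ) :=
  (ENNReal.ofReal (∫ x, f x ∂μ))⁻¹ • ((μ.prod volume).restrict (susp X f))

/-- `K(ν,t,H,Λ_f) = log ν{p ∈ Λ_f : Φ_f^s p ∉ H for all s ∈ [0,t]}`, valued in `EReal`
(so that `log 0 = ⊥`). -/
def Kc {a : ℕ} (ν : Measure ((ℕ → Fin a) × ℝ)) (t : ℝ) (H : Set ((ℕ → Fin a) × ℝ))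
    (X : Set (ℕ → Fin a)) (f : (ℕ → Fin a) → ℝ) : EReal :=
  ENNReal.log (ν {p | p ∈ susp X f ∧ ∀ s ∈ Set.Icc (0 : ℝ) t, susFlow f s p ∉ H})


lemma isClosed_SFT {a : ℕ} (A : Matrix (Fin a) (Fin a) ℕ) : IsClosed (SFT A) := by
  have h : SFT A = ⋂ n : ℕ, (fun x : ℕ → Fin a => (x n, x (n + 1))) ⁻¹'
      {q : Fin a × Fin a | A q.1 q.2 = 1} := by
    ext x
    simp [SFT]
  rw [h]
  exact isClosed_iInter fun n =>
    (isClosed_discrete _).preimage ((continuous_apply n).prodMk (continuous_apply (n + 1)))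

lemma cyl_mem_nhds {a : ℕ} (x : ℕ → Fin a) (n : ℕ) : cyl x n ∈ nhds x := by
  have h : cyl x n = (Set.Iio n).pi fun i => {x i} := by
    ext y
    simp [cyl]
  rw [h]
  exact set_pi_mem_nhds (Set.finite_Iio n) fun i _ => by simp [nhds_discrete]

lemma iterate_shiftMap_mem_SFT {a : ℕ} {A : Matrix (Fin a) (Fin a) ℕ} {x : ℕ → Fin a}
    (hx : x ∈ SFT A) (k : ℕ) : (shiftMap a)^[k] x ∈ SFT A := by
  induction k with
  | zero => exact hx
  | succ k ih =>
    rw [Function.iterate_succ_apply']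
    exact fun n => ih (n + 1)

lemma continuousOn_of_cyl {a : ℕ} {X : Set (ℕ → Fin a)} {f : (ℕ → Fin a) → ℝ}
    (hf : ∀ x ∈ X, ∀ ε : ℝ, 0 < ε → ∃ n : ℕ, ∀ y ∈ X ∩ cyl x n, |f x - f y| < ε) :
    ContinuousOn f X := by
  intro x hx
  refine Metric.tendsto_nhds.2 fun ε hε => ?_
  obtain ⟨n, hn⟩ := hf x hx ε hε
  filter_upwards [inter_mem_nhdsWithin X (cyl_mem_nhds x n)] with y hy
  rw [dist_comm, Real.dist_eq]
  exact hn y hy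

/-- A function that is continuous on a closed set of full measure in the full shift is
integrable. -/
lemma integrable_of_continuousOn {a : ℕ} {X : Set (ℕ → Fin a)} (hX : IsClosed X)
    {μ : Measure (ℕ → Fin a)} [IsFiniteMeasure μ] (hμ : ∀ᵐ x ∂μ, x ∈ X)
    {f : (ℕ → Fin a) → ℝ} (hf : ContinuousOn f X) : Integrable f μ := by
  have h : IntegrableOn f X μ := hf.integrableOn_compact hX.isCompact
  rwa [IntegrableOn, Measure.restrict_eq_self_of_ae_mem hμ] at h

lemma integral_pos_of_ae_pos {α : Type*} [MeasurableSpace α] {μ : Measure α} [NeZero μ]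
    {f : α → ℝ} (hf : Integrable f μ) (hpos : ∀ᵐ x ∂μ, 0 < f x) : 0 < ∫ x, f x ∂μ := by
  rw [integral_pos_iff_support_of_nonneg_ae (hpos.mono fun _ h => h.le) hf]
  have h : Function.support f =ᵐ[μ] Set.univ :=
    eventuallyEq_univ.2 (hpos.mono fun _ h => h.ne')
  rw [measure_congr h]
  exact NeZero.pos _

lemma birkhoff_strictMono {a : ℕ} {f : (ℕ → Fin a) → ℝ} {x : ℕ → Fin a}
    (hf : ∀ k, 0 < f ((shiftMap a)^[k] x)) : StrictMono fun m => birkhoff f m x :=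
  strictMono_nat_of_lt_succ fun m => by
    simpa [birkhoff, Finset.sum_range_succ] using hf m

lemma susFlow_eq {a : ℕ} {f : (ℕ → Fin a) → ℝ} {p : (ℕ → Fin a) × ℝ}
    (hf : ∀ k, 0 < f ((shiftMap a)^[k] p.1)) {m : ℕ} {s : ℝ}
    (h₁ : birkhoff f m p.1 ≤ p.2 + s) (h₂ : p.2 + s < birkhoff f (m + 1) p.1) :
    susFlow f s p = ((shiftMap a)^[m] p.1, p.2 + s - birkhoff f m p.1) := by
  have hmono := birkhoff_strictMono hf
  have h : ∃ m : ℕ, birkhoff f m p.1 ≤ p.2 + s ∧ p.2 + s < birkhoff f (m + 1) p.1 :=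
    ⟨m, h₁, h₂⟩
  have hle : h.choose < m + 1 := hmono.lt_iff_lt.1 (h.choose_spec.1.trans_lt h₂)
  have hge : m < h.choose + 1 := hmono.lt_iff_lt.1 (h₁.trans_lt h.choose_spec.2)
  have heq : h.choose = m := by omega
  rw [susFlow, dif_pos h, heq]

lemma susFlow_zero {a : ℕ} {f : (ℕ → Fin a) → ℝ} {p : (ℕ → Fin a) × ℝ}
    (hf : ∀ k, 0 < f ((shiftMap a)^[k] p.1)) (h₀ : 0 ≤ p.2) (h₁ : p.2 < f p.1) :
    susFlow f 0 p = p := by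
  rw [susFlow_eq (m := 0) hf (by simpa [birkhoff] using h₀) (by simpa [birkhoff] using h₁)]
  simp [birkhoff]

/-- If the `f`-orbit of a point below the smaller roof `g` meets `I × {0}` at time `s`, then its
`g`-orbit meets `I × {0}` no later than `s`. -/
lemma exists_susFlow_mem_of_le {a : ℕ} {g f : (ℕ → Fin a) → ℝ} {p : (ℕ → Fin a) × ℝ}
    (hg : ∀ k, 0 < g ((shiftMap a)^[k] p.1))
    (hgf : ∀ k, g ((shiftMap a)^[k] p.1) ≤ f ((shiftMap a)^[k] p.1))
    (h₀ : 0 ≤ p.2) (h₁ : p.2 < g p.1) {I : Set (ℕ → Fin a)} {s : ℝ} (hs : 0 ≤ s)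
    (hmem : susFlow f s p ∈ I ×ˢ ({0} : Set ℝ)) :
    ∃ r ∈ Set.Icc 0 s, susFlow g r p ∈ I ×ˢ ({0} : Set ℝ) := by
  by_cases h : ∃ m : ℕ, birkhoff f m p.1 ≤ p.2 + s ∧ p.2 + s < birkhoff f (m + 1) p.1
  · obtain ⟨m, hm₁, hm₂⟩ := h
    rw [susFlow_eq (fun k => (hg k).trans_le (hgf k)) hm₁ hm₂] at hmem
    obtain ⟨hI, hz⟩ := hmem
    have hz : p.2 + s - birkhoff f m p.1 = 0 := hz
    have hmono := birkhoff_strictMono hg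
    rcases Nat.eq_zero_or_pos m with rfl | hm
    · have hz' : p.2 + s = 0 := by simpa [birkhoff] using hz
      refine ⟨0, ⟨le_rfl, hs⟩, ?_⟩
      rw [susFlow_zero hg h₀ h₁]
      exact ⟨hI, show p.2 = 0 by linarith⟩
    · have hle : birkhoff g m p.1 ≤ birkhoff f m p.1 := Finset.sum_le_sum fun k _ => hgf k
      have hone : birkhoff g 1 p.1 ≤ birkhoff g m p.1 := hmono.monotone hm
      have hone' : birkhoff g 1 p.1 = g p.1 := by simp [birkhoff]
      have hlt : birkhoff g m p.1 < birkhoff g (m + 1) p.1 := hmono (Nat.lt_succ_self m)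
      refine ⟨birkhoff g m p.1 - p.2, ⟨by linarith, by linarith⟩, ?_⟩
      rw [susFlow_eq (m := m) hg (by linarith) (by linarith)]
      exact ⟨hI, show p.2 + (birkhoff g m p.1 - p.2) - birkhoff g m p.1 = 0 by ring⟩
  · rw [susFlow, dif_neg h] at hmem
    refine ⟨0, ⟨le_rfl, hs⟩, ?_⟩
    rwa [susFlow_zero hg h₀ h₁]

lemma suspMeasure_apply_of_subset {a : ℕ} (μ : Measure (ℕ → Fin a)) [SFinite μ]
    {X : Set (ℕ → Fin a)} {f : (ℕ → Fin a) → ℝ} {E : Set ((ℕ → Fin a) × ℝ)}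
    (hE : E ⊆ susp X f) :
    suspMeasure μ X f E = (ENNReal.ofReal (∫ x, f x ∂μ))⁻¹ * (μ.prod volume) E := by
  rw [suspMeasure, Measure.smul_apply, Measure.restrict_eq_self _ hE, smul_eq_mul]


/-- If `g ≤ f`, the set of points of `Λ_g` whose `Φ_g`-orbit avoids
`I × {0}` up to time `t` is contained (inside `Λ_f`) in the corresponding set for `Φ_f`,
and consequently `K(μ^g,t,I×{0},Λ_g) + log(∫g dμ/∫f dμ) ≤ K(μ^f,t,I×{0},Λ_f)`. -/
theorem K_monotone_in_roof
    (a : ℕ) (ha : 2 ≤ a) (A : Matrix (Fin a) (Fin a) ℕ)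
    (hA01 : ∀ i j, A i j = 0 ∨ A i j = 1)
    (hAper : ∃ d : ℕ, 0 < d ∧ ∀ i j, 0 < (A ^ d) i j)
    (μ : Measure (ℕ → Fin a)) [IsProbabilityMeasure μ]
    (hsupp : μ (SFT A) = 1)
    (hinv : ∀ B : Set (ℕ → Fin a), MeasurableSet B → μ (shiftMap a ⁻¹' B) = μ B)
    (g f : (ℕ → Fin a) → ℝ)
    (hgpos : ∀ x ∈ SFT A, 0 < g x) (hfpos : ∀ x ∈ SFT A, 0 < f x)
    (hgcont : ∀ x ∈ SFT A, ∀ ε : ℝ, 0 < ε → ∃ n : ℕ, ∀ y ∈ SFT A ∩ cyl x n, |g x - g y| < ε)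
    (hfcont : ∀ x ∈ SFT A, ∀ ε : ℝ, 0 < ε → ∃ n : ℕ, ∀ y ∈ SFT A ∩ cyl x n, |f x - f y| < ε)
    (hgf : ∀ x ∈ SFT A, g x ≤ f x)
    (I : Set (ℕ → Fin a)) (hI : MeasurableSet I) (hIX : I ⊆ SFT A)
    (t : ℝ) (ht : 0 < t) :
    {p : (ℕ → Fin a) × ℝ | p ∈ susp (SFT A) g ∧
        ∀ s ∈ Set.Icc (0 : ℝ) t, susFlow g s p ∉ I ×ˢ ({0} : Set ℝ)} ⊆
      {p : (ℕ → Fin a) × ℝ | p ∈ susp (SFT A) f ∧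
        ∀ s ∈ Set.Icc (0 : ℝ) t, susFlow f s p ∉ I ×ˢ ({0} : Set ℝ)} ∧
    Kc (suspMeasure μ (SFT A) g) t (I ×ˢ ({0} : Set ℝ)) (SFT A) g +
        ((Real.log ((∫ x, g x ∂μ) / (∫ x, f x ∂μ)) : ℝ) : EReal) ≤
      Kc (suspMeasure μ (SFT A) f) t (I ×ˢ ({0} : Set ℝ)) (SFT A) f := by
  have hsub : {p : (ℕ → Fin a) × ℝ | p ∈ susp (SFT A) g ∧
        ∀ s ∈ Set.Icc (0 : ℝ) t, susFlow g s p ∉ I ×ˢ ({0} : Set ℝ)} ⊆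
      {p : (ℕ → Fin a) × ℝ | p ∈ susp (SFT A) f ∧
        ∀ s ∈ Set.Icc (0 : ℝ) t, susFlow f s p ∉ I ×ˢ ({0} : Set ℝ)} := by
    rintro p ⟨⟨hp, h₀, h₁⟩, havoid⟩
    refine ⟨⟨hp, h₀, h₁.trans_le (hgf _ hp)⟩, fun s hs hmem => ?_⟩
    have horbit := iterate_shiftMap_mem_SFT hp
    obtain ⟨r, hr, hr'⟩ := exists_susFlow_mem_of_le (fun k => hgpos _ (horbit k))
      (fun k => hgf _ (horbit k)) h₀ h₁ hs.1 hmem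
    exact havoid r ⟨hr.1, hr.2.trans hs.2⟩ hr'
  refine ⟨hsub, ?_⟩
  have hX := isClosed_SFT A
  have hae : ∀ᵐ x ∂μ, x ∈ SFT A :=
    (mem_ae_iff_prob_eq_one hX.measurableSet).2 hsupp
  have hG : 0 < ∫ x, g x ∂μ := integral_pos_of_ae_pos
    (integrable_of_continuousOn hX hae (continuousOn_of_cyl hgcont)) (hae.mono hgpos)
  have hF : 0 < ∫ x, f x ∂μ := integral_pos_of_ae_pos
    (integrable_of_continuousOn hX hae (continuousOn_of_cyl hfcont)) (hae.mono hfpos)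
  rw [Kc, Kc, suspMeasure_apply_of_subset μ fun p hp => hp.1,
    suspMeasure_apply_of_subset μ fun p hp => hp.1,
    ← ENNReal.log_ofReal_of_pos (div_pos hG hF), ← ENNReal.log_mul_add]
  refine ENNReal.log_monotone ?_
  rw [ENNReal.ofReal_div_of_pos hF, div_eq_mul_inv, mul_mul_mul_comm,
    ENNReal.inv_mul_cancel (ENNReal.ofReal_pos.2 hG).ne' ENNReal.ofReal_ne_top, one_mul, mul_comm]
  gcongr

end
end

section
/- Let X be a one-sided subshift of finite type, μ a σ-invariant Borel probability measure, δ > 0, m ∈ ℕ, and let g : X → (0,∞) be constant on every cylinder of length m with values in δℤ and g ≥ δ. Let T_g be the discrete suspension map on Λ̃_g with measure μ̃^g, and let Φ_g^t be the special semi-flow on Λ_f with measure μ^g. Then for every Borel set I ⊆ X that is a union of cylinders of length at least m, and every k ∈ ℕ: K_D(μ̃^g, k, I×{0}) = K(μ^g, δk, I×{0}, Λ_g), i.e. the discrete-time and continuous-time non-escape quantities coincide at times that are multiples of δ. -/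
open Filter Set MeasureTheory

noncomputable section

/-- The discrete suspension space `Λ̃_g = {(x,j) : x ∈ X, 0 ≤ j < g(x)/δ}`. -/
def discSusp {a : ℕ} (X : Set (ℕ → Fin a)) (g : (ℕ → Fin a) → ℝ) (δ : ℝ) :
    Set ((ℕ → Fin a) × ℤ) :=
  {p | p.1 ∈ X ∧ 0 ≤ p.2 ∧ ((p.2 : ℤ) : ℝ) < g p.1 / δ}

open Classical in
/-- The discrete suspension map `T_g(x,j) = (x,j+1)` if `j+1 < g(x)/δ`, and
`T_g(x,j) = (σ x, 0)` if `j+1 = g(x)/δ`. -/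
def discT {a : ℕ} (g : (ℕ → Fin a) → ℝ) (δ : ℝ) (p : (ℕ → Fin a) × ℤ) :
    (ℕ → Fin a) × ℤ :=
  if ((p.2 + 1 : ℤ) : ℝ) < g p.1 / δ then (p.1, p.2 + 1) else (shiftMap a p.1, 0)

/-- The discrete suspension measure `μ̃^g = (δ/∫g dμ)·(μ × counting)` restricted to `Λ̃_g`. -/
def discMeasure {a : ℕ} (μ : Measure (ℕ → Fin a)) [SFinite μ] (X : Set (ℕ → Fin a))
    (g : (ℕ → Fin a) → ℝ) (δ : ℝ) : Measure ((ℕ → Fin a) × ℤ) :=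
  (ENNReal.ofReal (δ / ∫ x, g x ∂μ)) •
    ((μ.prod (Measure.count : Measure ℤ)).restrict (discSusp X g δ))

/-- `K_D(ν̃, k, H) = log ν̃{y ∈ Λ̃_g : T_g^i y ∉ H for i = 0,…,k−1}`, valued in `EReal`. -/
def KD {a : ℕ} (ν : Measure ((ℕ → Fin a) × ℤ)) (k : ℕ) (H : Set ((ℕ → Fin a) × ℤ))
    (X : Set (ℕ → Fin a)) (g : (ℕ → Fin a) → ℝ) (δ : ℝ) : EReal :=
  ENNReal.log (ν {p | p ∈ discSusp X g δ ∧ ∀ i < k, (discT g δ)^[i] p ∉ H})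

section Roof

variable {a : ℕ} {g : (ℕ → Fin a) → ℝ} {δ : ℝ}

theorem birkhoff_zero (x : ℕ → Fin a) : birkhoff g 0 x = 0 := by simp [birkhoff]

theorem birkhoff_succ (n : ℕ) (x : ℕ → Fin a) :
    birkhoff g (n + 1) x = birkhoff g n x + g ((shiftMap a)^[n] x) := by
  simp [birkhoff, Finset.sum_range_succ]

theorem birkhoff_succ' (n : ℕ) (x : ℕ → Fin a) :
    birkhoff g (n + 1) x = g x + birkhoff g n (shiftMap a x) := by
  simp [birkhoff, Finset.sum_range_succ', add_comm]

theorem birkhoff_strictMono_s6 (hδ : 0 < δ) (hgδ : ∀ x, δ ≤ g x) (x : ℕ → Fin a) :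
    StrictMono fun n => birkhoff g n x :=
  strictMono_nat_of_lt_succ fun n => by
    simp only [birkhoff_succ]
    linarith [hgδ ((shiftMap a)^[n] x)]

theorem nat_mul_le_birkhoff (hgδ : ∀ x, δ ≤ g x) (n : ℕ) (x : ℕ → Fin a) :
    n * δ ≤ birkhoff g n x := by
  induction n with
  | zero => simp [birkhoff_zero]
  | succ n ih =>
    rw [birkhoff_succ]
    push_cast
    linarith [hgδ ((shiftMap a)^[n] x)]

theorem exists_birkhoff_eq_int_mul (hgval : ∀ x, ∃ j : ℤ, g x = j * δ) (n : ℕ)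
    (x : ℕ → Fin a) : ∃ j : ℤ, birkhoff g n x = j * δ := by
  induction n with
  | zero => exact ⟨0, by simp [birkhoff_zero]⟩
  | succ n ih =>
    obtain ⟨i, hi⟩ := ih
    obtain ⟨j, hj⟩ := hgval ((shiftMap a)^[n] x)
    exact ⟨i + j, by rw [birkhoff_succ, hi, hj]; push_cast; ring⟩

theorem exists_birkhoff_le_lt (hδ : 0 < δ) (hgδ : ∀ x, δ ≤ g x) (x : ℕ → Fin a) {u : ℝ}
    (hu : 0 ≤ u) : ∃ n : ℕ, birkhoff g n x ≤ u ∧ u < birkhoff g (n + 1) x := by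
  classical
  have hex : ∃ n : ℕ, u < birkhoff g n x := by
    obtain ⟨n, hn⟩ := exists_nat_gt (u / δ)
    exact ⟨n, ((div_lt_iff₀ hδ).1 hn).trans_le (nat_mul_le_birkhoff hgδ n x)⟩
  obtain ⟨n, hn⟩ : ∃ n, Nat.find hex = n + 1 := Nat.exists_eq_succ_of_ne_zero fun h => by
    have := Nat.find_spec hex
    rw [h, birkhoff_zero] at this
    linarith
  exact ⟨n, not_lt.1 (Nat.find_min hex (by omega)), hn ▸ Nat.find_spec hex⟩

theorem susFlow_mem_prod_zero_iff (hδ : 0 < δ) (hgδ : ∀ x, δ ≤ g x) (I : Set (ℕ → Fin a))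
    (x : ℕ → Fin a) {s t : ℝ} (hs : 0 ≤ s) (ht : 0 ≤ t) :
    susFlow g t (x, s) ∈ I ×ˢ ({0} : Set ℝ) ↔
      ∃ n : ℕ, birkhoff g n x = s + t ∧ (shiftMap a)^[n] x ∈ I := by
  have hex : ∃ n : ℕ, birkhoff g n (x, s).1 ≤ (x, s).2 + t ∧
      (x, s).2 + t < birkhoff g (n + 1) (x, s).1 :=
    exists_birkhoff_le_lt hδ hgδ x (add_nonneg hs ht)
  have hmono := birkhoff_strictMono_s6 hδ hgδ x
  rw [susFlow, dif_pos hex]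
  have hc := hex.choose_spec
  generalize hex.choose = c at hc
  simp only [Set.mem_prod, Set.mem_singleton_iff] at hc ⊢
  constructor
  · rintro ⟨h1, h2⟩
    exact ⟨c, by linarith, h1⟩
  · rintro ⟨n, h1, h2⟩
    have h3 : c ≤ n := hmono.le_iff_le.1 (by simpa [h1] using hc.1)
    have h4 : n < c + 1 := hmono.lt_iff_lt.1 (by simpa [h1] using hc.2)
    obtain rfl : c = n := by omega
    exact ⟨h2, by linarith⟩

theorem roof_eq_of_not_lt (hδ : 0 < δ) (hgval : ∀ x, ∃ j : ℤ, g x = j * δ) {x : ℕ → Fin a}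
    {j : ℤ} (hj : (j : ℝ) < g x / δ) (h : ¬ ((j + 1 : ℤ) : ℝ) < g x / δ) :
    g x / δ = ((j + 1 : ℤ) : ℝ) := by
  obtain ⟨n, hn⟩ := hgval x
  have hx : g x / δ = n := by rw [hn, mul_div_cancel_right₀ _ hδ.ne']
  rw [hx, Int.cast_lt] at hj h
  rw [hx, Int.cast_inj]
  omega

theorem discT_iterate_mem_prod_zero_iff (hδ : 0 < δ) (hgδ : ∀ x, δ ≤ g x)
    (hgval : ∀ x, ∃ j : ℤ, g x = j * δ) (I : Set (ℕ → Fin a)) (i : ℕ) (x : ℕ → Fin a) (j : ℤ)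
    (hj0 : 0 ≤ j) (hj : (j : ℝ) < g x / δ) :
    (discT g δ)^[i] (x, j) ∈ I ×ˢ ({0} : Set ℤ) ↔
      ∃ n : ℕ, birkhoff g n x = (j + i) * δ ∧ (shiftMap a)^[n] x ∈ I := by
  induction i generalizing x j with
  | zero =>
    simp only [Function.iterate_zero, id, Set.mem_prod, Set.mem_singleton_iff]
    constructor
    · rintro ⟨h1, h2⟩
      exact ⟨0, by simp [birkhoff_zero, h2], h1⟩
    · rintro ⟨n, h1, h2⟩
      have h3 : n < 1 := (birkhoff_strictMono_s6 hδ hgδ x).lt_iff_lt.1 (by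
        simp only [h1, birkhoff_succ, birkhoff_zero]
        simpa using (lt_div_iff₀ hδ).1 hj)
      obtain rfl : n = 0 := by omega
      rw [birkhoff_zero] at h1
      have : (j : ℝ) = 0 := by simpa [hδ.ne'] using h1.symm
      exact ⟨h2, by exact_mod_cast this⟩
  | succ i ih =>
    rw [Function.iterate_succ_apply, discT]
    split_ifs with h
    · rw [ih x (j + 1) (by omega) h]
      push_cast
      simp only [add_assoc, add_comm (1 : ℝ)]
    · have hx := roof_eq_of_not_lt hδ hgval hj h
      rw [ih _ 0 le_rfl (by simpa using div_pos (hδ.trans_le (hgδ _)) hδ)]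
      have hgx : g x = (j + 1) * δ := by
        rw [div_eq_iff hδ.ne'] at hx
        exact_mod_cast hx
      constructor
      · rintro ⟨n, h1, h2⟩
        refine ⟨n + 1, ?_, h2⟩
        rw [birkhoff_succ', h1, hgx]
        push_cast
        ring
      · rintro ⟨n, h1, h2⟩
        cases n with
        | zero =>
          have : (0 : ℝ) ≤ j := by exact_mod_cast hj0
          rw [birkhoff_zero] at h1
          have : 0 < (j + ((i + 1 : ℕ) : ℝ)) * δ := by positivity
          linarith
        | succ n =>
          refine ⟨n, ?_, h2⟩
          rw [birkhoff_succ', hgx] at h1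
          push_cast at h1 ⊢
          linarith

theorem floor_mem_discSusp_iff (hδ : 0 < δ) (hgval : ∀ x, ∃ j : ℤ, g x = j * δ)
    (X : Set (ℕ → Fin a)) (x : ℕ → Fin a) (s : ℝ) :
    (x, ⌊s / δ⌋) ∈ discSusp X g δ ↔ (x, s) ∈ susp X g := by
  obtain ⟨n, hn⟩ := hgval x
  simp only [discSusp, susp, Set.mem_ofPred_eq, hn, mul_div_cancel_right₀ _ hδ.ne', Int.cast_lt,
    Int.floor_lt, Int.floor_nonneg, div_lt_iff₀ hδ, le_div_iff₀ hδ, zero_mul]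

/-- Off the multiples of `δ`, continuous non-escape up to time `δ k` is discrete non-escape at
the times `1, …, k`. -/
theorem susFlow_survival_iff (hδ : 0 < δ) (hgδ : ∀ x, δ ≤ g x)
    (hgval : ∀ x, ∃ j : ℤ, g x = j * δ) (I X : Set (ℕ → Fin a)) (k : ℕ) (x : ℕ → Fin a) (s : ℝ)
    (hsδ : ∀ n : ℤ, s ≠ n * δ) :
    ((x, s) ∈ susp X g ∧
        ∀ t ∈ Set.Icc (0 : ℝ) (δ * k), susFlow g t (x, s) ∉ I ×ˢ ({0} : Set ℝ)) ↔
      ((x, ⌊s / δ⌋) ∈ discSusp X g δ ∧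
        ∀ i < k, (discT g δ)^[i + 1] (x, ⌊s / δ⌋) ∉ I ×ˢ ({0} : Set ℤ)) := by
  rw [floor_mem_discSusp_iff hδ hgval]
  refine and_congr_right fun hx => not_iff_not.1 ?_
  have hx' := (floor_mem_discSusp_iff hδ hgval X x s).2 hx
  have hlo : (⌊s / δ⌋ : ℝ) * δ ≤ s := (le_div_iff₀ hδ).1 (Int.floor_le _)
  have hhi : s < (⌊s / δ⌋ + 1) * δ := (div_lt_iff₀ hδ).1 (Int.lt_floor_add_one _)
  have hlo' : (⌊s / δ⌋ : ℝ) * δ < s := lt_of_le_of_ne hlo (hsδ _).symm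
  push Not
  constructor
  · rintro ⟨t, ht, h⟩
    obtain ⟨n, h1, h2⟩ := (susFlow_mem_prod_zero_iff hδ hgδ I x hx.2.1 ht.1).1 h
    obtain ⟨l, hl⟩ := exists_birkhoff_eq_int_mul hgval n x
    have hl1 : ⌊s / δ⌋ < l := by
      have : (⌊s / δ⌋ : ℝ) * δ < l * δ := by linarith [ht.1]
      exact_mod_cast lt_of_mul_lt_mul_right this hδ.le
    have hl2 : l < ⌊s / δ⌋ + 1 + k := by
      have : (l : ℝ) * δ < (⌊s / δ⌋ + 1 + k) * δ := by linarith [ht.2]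
      exact_mod_cast lt_of_mul_lt_mul_right this hδ.le
    obtain ⟨i, hi⟩ : ∃ i : ℕ, l = ⌊s / δ⌋ + (i + 1 : ℕ) :=
      ⟨(l - ⌊s / δ⌋ - 1).toNat, by omega⟩
    refine ⟨i, by omega,
      (discT_iterate_mem_prod_zero_iff hδ hgδ hgval I _ x _ hx'.2.1 hx'.2.2).2 ⟨n, ?_, h2⟩⟩
    rw [hl, hi]
    push_cast
    ring
  · rintro ⟨i, hi, h⟩
    obtain ⟨n, h1, h2⟩ :=
      (discT_iterate_mem_prod_zero_iff hδ hgδ hgval I _ x _ hx'.2.1 hx'.2.2).1 h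
    have hik : ((i + 1 : ℕ) : ℝ) * δ ≤ k * δ :=
      mul_le_mul_of_nonneg_right (by exact_mod_cast hi) hδ.le
    have hi0 : 0 ≤ (i : ℝ) * δ := by positivity
    push_cast at hik
    have ht : (⌊s / δ⌋ + ((i + 1 : ℕ) : ℝ)) * δ - s ∈ Set.Icc (0 : ℝ) (δ * k) := by
      push_cast
      constructor <;> linarith
    exact ⟨_, ht, (susFlow_mem_prod_zero_iff hδ hgδ I x hx.2.1 ht.1).2
      ⟨n, by rw [h1]; ring, h2⟩⟩

theorem exists_eq_comp_prefix (ha : 0 < a) (m : ℕ)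
    (hg : ∀ x y : ℕ → Fin a, (∀ i < m, x i = y i) → g x = g y) :
    ∃ G : (Fin m → Fin a) → ℝ, g = G ∘ fun x (i : Fin m) => x i :=
  ⟨fun y => g fun i => if h : i < m then y ⟨i, h⟩ else ⟨0, ha⟩,
    funext fun _ => hg _ _ fun i hi => by simp [hi]⟩

theorem measurable_shiftMap (a : ℕ) : Measurable (shiftMap a) := by
  unfold shiftMap
  fun_prop

theorem measurableSet_SFT (A : Matrix (Fin a) (Fin a) ℕ) : MeasurableSet (SFT A) := by
  simp only [SFT, Set.ofPred_forall]
  refine MeasurableSet.iInter fun n => ?_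
  have h : Measurable fun x : ℕ → Fin a => (x n, x (n + 1)) := by fun_prop
  exact h (Set.toFinite {q : Fin a × Fin a | A q.1 q.2 = 1}).measurableSet

theorem shiftMap_mem_SFT {A : Matrix (Fin a) (Fin a) ℕ} {x : ℕ → Fin a} (hx : x ∈ SFT A) :
    shiftMap a x ∈ SFT A := fun n => hx (n + 1)

theorem discT_mem_discSusp (hδ : 0 < δ) (hgδ : ∀ x, δ ≤ g x) {X : Set (ℕ → Fin a)}
    (hX : ∀ x ∈ X, shiftMap a x ∈ X) {p : (ℕ → Fin a) × ℤ} (hp : p ∈ discSusp X g δ) :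
    discT g δ p ∈ discSusp X g δ := by
  rw [discT]
  split_ifs with h
  · exact ⟨hp.1, add_nonneg hp.2.1 zero_le_one, h⟩
  · exact ⟨hX _ hp.1, le_rfl, by simpa using div_pos (hδ.trans_le (hgδ _)) hδ⟩

theorem measurable_discT (hg : Measurable g) (δ : ℝ) : Measurable (discT g δ) := by
  unfold discT
  refine Measurable.ite (measurableSet_lt ?_ ?_) ?_ ?_
  · exact (measurable_of_countable fun j : ℤ => ((j + 1 : ℤ) : ℝ)).comp measurable_snd
  · exact (hg.comp measurable_fst).div_const δ
  · exact measurable_fst.prodMk ((measurable_of_countable (· + 1)).comp measurable_snd)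
  · exact ((measurable_shiftMap a).comp measurable_fst).prodMk measurable_const

theorem measurableSet_discSusp {X : Set (ℕ → Fin a)} (hX : MeasurableSet X) (hg : Measurable g)
    (δ : ℝ) : MeasurableSet (discSusp X g δ) := by
  refine (measurable_fst hX).inter (MeasurableSet.inter
    (measurable_snd (MeasurableSet.of_discrete : MeasurableSet {j : ℤ | 0 ≤ j}))
    (measurableSet_lt ?_ ((hg.comp measurable_fst).div_const δ)))
  exact (measurable_of_countable fun j : ℤ => (j : ℝ)).comp measurable_snd

theorem map_floor_div_volume (hδ : 0 < δ) :
    (volume : Measure ℝ).map (fun s => ⌊s / δ⌋) = ENNReal.ofReal δ • Measure.count := by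
  refine Measure.ext_of_singleton fun n => ?_
  have hm : Measurable fun s : ℝ => ⌊s / δ⌋ := Int.measurable_floor.comp (by fun_prop)
  have hset : (fun s : ℝ => ⌊s / δ⌋) ⁻¹' {n} = Set.Ico (n * δ) ((n + 1) * δ) := by
    ext s
    simp [Int.floor_eq_iff, le_div_iff₀ hδ, div_lt_iff₀ hδ]
  rw [Measure.map_apply hm (measurableSet_singleton n), hset, Real.volume_Ico]
  simp [add_mul]

theorem map_floor_div_prod_volume (μ : Measure (ℕ → Fin a)) [SFinite μ] (hδ : 0 < δ) :
    (μ.prod volume).map (Prod.map id fun s : ℝ => ⌊s / δ⌋) =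
      ENNReal.ofReal δ • μ.prod Measure.count := by
  have hm : Measurable fun s : ℝ => ⌊s / δ⌋ := Int.measurable_floor.comp (by fun_prop)
  rw [← Measure.map_prod_map _ _ measurable_id hm, map_floor_div_volume hδ, Measure.map_id,
    Measure.prod_smul_right]

theorem ae_prod_volume_ne_int_mul (μ : Measure (ℕ → Fin a)) [SFinite μ] (δ : ℝ) :
    ∀ᵐ p ∂μ.prod (volume : Measure ℝ), ∀ n : ℤ, p.2 ≠ n * δ := by
  have h : ∀ᵐ s : ℝ, ∀ n : ℤ, s ≠ n * δ := by
    rw [ae_all_iff]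
    exact fun n => Measure.ae_ne volume _
  exact Measure.quasiMeasurePreserving_snd.ae h

theorem count_eq_add_ite {S U : Set ℤ} {c : ℤ} {p : Prop} [Decidable p]
    (hS : S = U ∪ {j | j = c ∧ p}) (hc : c ∉ U) :
    Measure.count S = Measure.count U + if p then (1 : ENNReal) else 0 := by
  subst hS
  split_ifs with hp
  · simp only [hp, and_true]
    rw [measure_union (by simpa using hc) .of_discrete]
    simp
  · simp [hp]

/-- The discrete suspension map preserves `μ × counting` on the discrete suspension. -/
theorem prod_count_discT_preimage {A : Matrix (Fin a) (Fin a) ℕ} (μ : Measure (ℕ → Fin a))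
    [IsProbabilityMeasure μ] (hsupp : μ (SFT A) = 1)
    (hinv : ∀ B : Set (ℕ → Fin a), MeasurableSet B → μ (shiftMap a ⁻¹' B) = μ B)
    (hδ : 0 < δ) (hgδ : ∀ x, δ ≤ g x) (hgval : ∀ x, ∃ j : ℤ, g x = j * δ) (hg : Measurable g)
    {D : Set ((ℕ → Fin a) × ℤ)} (hD : MeasurableSet D) (hDS : D ⊆ discSusp (SFT A) g δ) :
    μ.prod Measure.count (discSusp (SFT A) g δ ∩ discT g δ ⁻¹' D) = μ.prod Measure.count D := by
  classical
  have hS := measurableSet_discSusp (measurableSet_SFT A) hg δ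
  let D₀ : Set (ℕ → Fin a) := (fun x => (x, (0 : ℤ))) ⁻¹' D
  have hD₀ : MeasurableSet D₀ := (by fun_prop : Measurable fun x : ℕ → Fin a => (x, (0 : ℤ))) hD
  let F : (ℕ → Fin a) → ENNReal := fun x => Measure.count {j : ℤ | 1 ≤ j ∧ (x, j) ∈ D}
  have hF : Measurable F := measurable_measure_prodMk_left
    ((measurable_snd (MeasurableSet.of_discrete : MeasurableSet {j : ℤ | 1 ≤ j})).inter hD)
  have hae : ∀ᵐ x ∂μ, x ∈ SFT A := by
    rw [← prob_compl_eq_zero_iff (measurableSet_SFT A)] at hsupp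
    exact hsupp
  have hfib : ∀ x ∈ SFT A,
      Measure.count (Prod.mk x ⁻¹' (discSusp (SFT A) g δ ∩ discT g δ ⁻¹' D)) =
        F x + D₀.indicator 1 (shiftMap a x) := by
    intro x hx
    obtain ⟨N, hN⟩ := hgval x
    have hN1 : 1 ≤ N := by
      have : (1 : ℝ) * δ ≤ N * δ := by linarith [hgδ x]
      exact_mod_cast le_of_mul_le_mul_right this hδ
    have hNx : g x / δ = N := by rw [hN, mul_div_cancel_right₀ _ hδ.ne']
    have hinj : Function.Injective fun j : ℤ => j - 1 := sub_left_injective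
    have hFx : F x = Measure.count ((fun j : ℤ => j - 1) '' {j : ℤ | 1 ≤ j ∧ (x, j) ∈ D}) :=
      (Measure.count_injective_image hinj _).symm
    rw [Set.indicator_apply, Pi.one_apply, hFx]
    have hDN : ∀ j, (x, j) ∈ D → j < N := fun j hj => by
      have := (hDS hj).2.2
      rw [hNx] at this
      exact_mod_cast this
    refine count_eq_add_ite (c := N - 1) ?_ ?_
    · ext j
      have hT : discT g δ (x, j) = if j + 1 < N then (x, j + 1) else (shiftMap a x, 0) := by
        simp only [discT, hNx, Int.cast_lt]
      have hmem : (x, j) ∈ discSusp (SFT A) g δ ↔ 0 ≤ j ∧ j < N := by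
        simp [discSusp, hNx, hx]
      have himg : j ∈ (fun j : ℤ => j - 1) '' {j : ℤ | 1 ≤ j ∧ (x, j) ∈ D} ↔
          0 ≤ j ∧ (x, j + 1) ∈ D := by
        constructor
        · rintro ⟨i, ⟨h1, h2⟩, rfl⟩
          exact ⟨by simpa using h1, by simpa using h2⟩
        · rintro ⟨h1, h2⟩
          exact ⟨j + 1, ⟨by omega, h2⟩, by simp⟩
      rw [Set.mem_preimage, Set.mem_inter_iff, Set.mem_preimage, hmem, hT, Set.mem_union, himg]
      change _ ↔ _ ∨ j = N - 1 ∧ (shiftMap a x, 0) ∈ D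
      split_ifs with h
      · constructor
        · rintro ⟨h1, h2⟩
          exact Or.inl ⟨h1.1, h2⟩
        · rintro (⟨h1, h2⟩ | ⟨h1, -⟩)
          · exact ⟨⟨h1, by omega⟩, h2⟩
          · omega
      · constructor
        · rintro ⟨h1, h2⟩
          exact Or.inr ⟨by omega, h2⟩
        · rintro (⟨-, h2⟩ | ⟨h1, h2⟩)
          · exact absurd (hDN _ h2) h
          · exact ⟨by omega, h2⟩
    · rintro ⟨i, ⟨-, h2⟩, h3⟩
      have := hDN _ h2
      simp only at h3
      omega
  have hfib' : ∀ x, Measure.count (Prod.mk x ⁻¹' D) = F x + D₀.indicator 1 x := by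
    intro x
    rw [Set.indicator_apply, Pi.one_apply]
    refine count_eq_add_ite (c := 0) ?_ (by simp)
    ext j
    change (x, j) ∈ D ↔ (1 ≤ j ∧ (x, j) ∈ D) ∨ (j = 0 ∧ (x, 0) ∈ D)
    constructor
    · intro h
      have h0 : 0 ≤ j := (hDS h).2.1
      rcases h0.eq_or_lt with rfl | h0
      · exact Or.inr ⟨rfl, h⟩
      · exact Or.inl ⟨by omega, h⟩
    · rintro (⟨-, h⟩ | ⟨rfl, h⟩) <;> exact h
  rw [Measure.prod_apply (hS.inter (measurable_discT hg δ hD)), Measure.prod_apply hD,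
    lintegral_congr_ae (hae.mono hfib), lintegral_congr hfib', lintegral_add_left hF,
    lintegral_add_left hF]
  congr 1
  rw [lintegral_indicator_one hD₀, ← hinv D₀ hD₀,
    ← lintegral_indicator_one (measurable_shiftMap a hD₀)]
  rfl

end Roof

/-- For a roof function `g` constant on cylinders of length `m` with values
in `δℤ`, the discrete-time and continuous-time non-escape quantities through a union of
cylinders of length at least `m` coincide at times which are multiples of `δ`. -/
theorem discrete_continuous_K_eq
    (a : ℕ) (ha : 2 ≤ a) (A : Matrix (Fin a) (Fin a) ℕ)
    (hA01 : ∀ i j, A i j = 0 ∨ A i j = 1)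
    (hAper : ∃ d : ℕ, 0 < d ∧ ∀ i j, 0 < (A ^ d) i j)
    (μ : Measure (ℕ → Fin a)) [IsProbabilityMeasure μ]
    (hsupp : μ (SFT A) = 1)
    (hinv : ∀ B : Set (ℕ → Fin a), MeasurableSet B → μ (shiftMap a ⁻¹' B) = μ B)
    (δ : ℝ) (hδ : 0 < δ) (m : ℕ)
    (g : (ℕ → Fin a) → ℝ)
    (hgconst : ∀ x y : ℕ → Fin a, (∀ i < m, x i = y i) → g x = g y)
    (hgval : ∀ x : ℕ → Fin a, ∃ j : ℤ, g x = j * δ)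
    (hgδ : ∀ x : ℕ → Fin a, δ ≤ g x)
    (I : Set (ℕ → Fin a)) (hI : MeasurableSet I) (hIX : I ⊆ SFT A)
    (hIcyl : ∀ x ∈ I, ∃ l : ℕ, m ≤ l ∧ SFT A ∩ cyl x l ⊆ I)
    (k : ℕ) :
    KD (discMeasure μ (SFT A) g δ) k (I ×ˢ ({0} : Set ℤ)) (SFT A) g δ =
      Kc (suspMeasure μ (SFT A) g) (δ * k) (I ×ˢ ({0} : Set ℝ)) (SFT A) g := by
  obtain ⟨G, hG⟩ := exists_eq_comp_prefix (by omega) m hgconst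
  have hg : Measurable g := hG ▸ (measurable_of_finite G).comp (by fun_prop)
  have hX := measurableSet_SFT A
  have hS := measurableSet_discSusp hX hg δ
  have hT := measurable_discT hg δ
  have hH : MeasurableSet (I ×ˢ ({0} : Set ℤ)) := hI.prod (measurableSet_singleton 0)
  have hint : 0 < ∫ x, g x ∂μ := by
    obtain ⟨M, hM⟩ : ∃ M, ∀ x, g x ≤ M := by
      obtain ⟨M, hM⟩ := (Set.finite_range G).bddAbove
      exact ⟨M, fun x => hG ▸ hM (Set.mem_range_self _)⟩
    have hgi : Integrable g μ := by
      refine Integrable.of_bound hg.aestronglyMeasurable M (ae_of_all _ fun x => ?_)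
      rw [Real.norm_of_nonneg (hδ.le.trans (hgδ x))]
      exact hM x
    have := integral_mono (integrable_const δ) hgi hgδ
    simp only [integral_const, probReal_univ, one_smul] at this
    linarith
  set D : Set ((ℕ → Fin a) × ℤ) :=
    {p | p ∈ discSusp (SFT A) g δ ∧ ∀ i < k, (discT g δ)^[i] p ∉ I ×ˢ ({0} : Set ℤ)} with hDdef
  set E : Set ((ℕ → Fin a) × ℝ) := {p | p ∈ susp (SFT A) g ∧
    ∀ s ∈ Set.Icc (0 : ℝ) (δ * k), susFlow g s p ∉ I ×ˢ ({0} : Set ℝ)}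
  have hDS : D ⊆ discSusp (SFT A) g δ := fun p hp => hp.1
  have hES : E ⊆ susp (SFT A) g := fun p hp => hp.1
  have hD : MeasurableSet D := by
    have h : D = discSusp (SFT A) g δ ∩ ⋂ i, ⋂ (_ : i < k),
        (discT g δ)^[i] ⁻¹' (I ×ˢ ({0} : Set ℤ))ᶜ := by
      ext p
      simp only [hDdef, Set.mem_ofPred_eq, Set.mem_inter_iff, Set.mem_iInter, Set.mem_preimage,
        Set.mem_compl_iff]
    rw [h]
    exact hS.inter (.iInter fun i => .iInter fun _ => hT.iterate i hH.compl)
  have hfl : Measurable fun s : ℝ => ⌊s / δ⌋ := Int.measurable_floor.comp (by fun_prop)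
  have hE : E =ᵐ[μ.prod volume] Prod.map id (fun s : ℝ => ⌊s / δ⌋) ⁻¹'
      (discSusp (SFT A) g δ ∩ discT g δ ⁻¹' D) := by
    filter_upwards [ae_prod_volume_ne_int_mul μ δ] with p hp
    refine propext ((susFlow_survival_iff hδ hgδ hgval I (SFT A) k p.1 p.2 hp).trans ?_)
    refine and_congr_right fun h => (and_iff_right ?_).symm
    exact discT_mem_discSusp hδ hgδ (fun x hx => shiftMap_mem_SFT hx) h
  have key : μ.prod volume E = ENNReal.ofReal δ * μ.prod Measure.count D := by
    rw [measure_congr hE, ← Measure.map_apply (measurable_id.prodMap hfl) (hS.inter (hT hD)),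
      map_floor_div_prod_volume μ hδ, Measure.smul_apply, smul_eq_mul,
      prod_count_discT_preimage μ hsupp hinv hδ hgδ hgval hg hD hDS]
  rw [KD, Kc, discMeasure, suspMeasure, Measure.smul_apply, Measure.smul_apply,
    Measure.restrict_eq_self _ hDS, Measure.restrict_eq_self _ hES, key, smul_eq_mul, smul_eq_mul,
    ENNReal.ofReal_div_of_pos hint, div_eq_mul_inv]
  congr 1
  ring

end
end
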